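/- arXiv:2404.03464 — 3 statements merged into one kernel-verified Lean document; each statement's English description precedes it below -/
import Mathlib

section
/- For j even, the sequence (F_{n^j}) is not realizable, but the sequence (5 F_{n^j}) is realizable. -/
/-- A sequence `a : ℕ → ℕ` (indexed from 1) is realizable if there is a set `X`
and a map `T : X → X` such that for every `n ≥ 1` the set of points fixed by the
`n`-th iterate of `T` is finite with cardinality `a n`. -/
def IsRealizable (a : ℕ → ℕ) : Prop :=
  ∃ (X : Type) (T : X → X), ∀ n : ℕ, 1 ≤ n →
    {x : X | T^[n] x = x}.Finite ∧ {x : X | T^[n] x = x}.ncard = a n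

/-- The Möbius-transformed sum `∑_{d ∣ n} μ(n/d) a_d`. -/
def doldSum (a : ℕ → ℕ) (n : ℕ) : ℤ :=
  ∑ d ∈ n.divisors, (ArithmeticFunction.moebius (n / d) : ℤ) * (a d : ℤ)

theorem real_of_orbits (a c : ℕ → ℕ) (h : ∀ n, 1 ≤ n → ∑ d ∈ n.divisors, d * c d = a n) :
    IsRealizable a := by
  refine ⟨Σ n : ℕ, Fin (c (n+1)) × ZMod (n+1), fun x => ⟨x.1, x.2.1, x.2.2 + 1⟩, fun m hm => ?_⟩
  have hit : ∀ (k : ℕ) (x : Σ n : ℕ, Fin (c (n+1)) × ZMod (n+1)),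
      (fun x : (Σ n : ℕ, Fin (c (n+1)) × ZMod (n+1)) => (⟨x.1, x.2.1, x.2.2 + 1⟩ : Σ n : ℕ, Fin (c (n+1)) × ZMod (n+1)))^[k] x
        = ⟨x.1, x.2.1, x.2.2 + (k : ZMod (x.1+1))⟩ := by
    intro k
    induction k with
    | zero => intro x; simp
    | succ k ih =>
      intro x
      rw [Function.iterate_succ_apply', ih]
      simp [add_assoc]
  have hset : {x : Σ n : ℕ, Fin (c (n+1)) × ZMod (n+1) | (fun x : (Σ n : ℕ, Fin (c (n+1)) × ZMod (n+1)) => (⟨x.1, x.2.1, x.2.2 + 1⟩ : Σ n : ℕ, Fin (c (n+1)) × ZMod (n+1)))^[m] x = x}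
      = ↑(((Finset.range m).filter (fun n => n + 1 ∣ m)).sigma
          (fun n => (Finset.univ : Finset (Fin (c (n+1)) × ZMod (n+1))))) := by
    ext ⟨n, x, z⟩
    simp only [Set.mem_ofPred_eq, hit, Finset.coe_sigma, Set.mem_sigma_iff, Finset.coe_univ, Set.mem_univ, and_true, Finset.coe_filter, Finset.mem_range]
    constructor
    · intro h
      have : (m : ZMod (n+1)) = 0 := by simpa using h
      have h2 := (ZMod.natCast_eq_zero_iff _ _).1 this
      exact ⟨Nat.le_of_dvd hm h2, h2⟩
    · rintro ⟨_, h2⟩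
      have := (ZMod.natCast_eq_zero_iff _ _).2 h2
      simp [this]
  rw [hset]
  refine ⟨Finset.finite_toSet _, ?_⟩
  rw [Set.ncard_coe_finset, Finset.card_sigma, ← h m hm]
  refine Finset.sum_bij (fun n _ => n + 1) ?_ ?_ ?_ ?_
  · intro n hn
    simp at hn ⊢
    exact ⟨hn.2, by omega⟩
  · intro a _ b _ h; simpa using h
  · intro d hd
    have := Nat.pos_of_mem_divisors hd
    have h2 := Nat.divisor_le hd
    have h3 := Nat.dvd_of_mem_divisors hd
    refine ⟨d - 1, ?_, by omega⟩
    simp [Nat.sub_add_cancel this, h3]; omega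
  · intro n hn
    simp [ZMod.card, mul_comm]

theorem orbits_exist (a : ℕ → ℕ)
    (hpos : ∀ n, 1 ≤ n → ∑ d ∈ n.properDivisors, a d ≤ a n)
    (hdvd : ∀ p k m : ℕ, p.Prime → 1 ≤ m → ((p:ℤ) ^ (k+1)) ∣ (a (p^(k+1) * m) : ℤ) - a (p^k * m)) :
    IsRealizable a := by
  obtain ⟨b, hb⟩ : ∃ b : ℕ → ℤ, ∀ n > 0, ∑ d ∈ n.divisors, b d = (a n : ℤ) :=
    ⟨_, ArithmeticFunction.sum_eq_iff_sum_mul_moebius_eq.2 (fun n _ => rfl)⟩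
  have hb' : ∀ n > 0, ∑ d ∈ n.properDivisors, b d + b n = (a n : ℤ) := by
    intro n hn
    rw [← hb n hn, ← Nat.insert_self_properDivisors hn.ne',
      Finset.sum_insert Nat.self_notMem_properDivisors, add_comm]
  have h1 : ∀ n > 0, 0 ≤ b n ∧ b n ≤ a n := by
    intro n
    induction n using Nat.strong_induction_on with
    | _ n ih =>
      intro hn
      have e := hb' n hn
      have ih' : ∀ d ∈ n.properDivisors, 0 ≤ b d ∧ b d ≤ a d := fun d hd =>
        ih d (Nat.mem_properDivisors.1 hd).2 (Nat.pos_of_mem_properDivisors hd)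
      have s1 := Finset.sum_nonneg (fun d hd => (ih' d hd).1)
      have s2 := Finset.sum_le_sum (fun d hd => (ih' d hd).2)
      have s3 : (∑ d ∈ n.properDivisors, (a d : ℤ)) ≤ a n := by exact_mod_cast hpos n hn
      constructor <;> linarith
  have h2 : ∀ n : ℕ, n > 0 → (n : ℤ) ∣ b n := by
    intro n
    induction n using Nat.strong_induction_on with
    | _ n ih =>
      intro hn
      rw [Int.natCast_dvd, Nat.dvd_iff_prime_pow_dvd_dvd]
      intro p k hp hk
      rw [← Int.natCast_dvd]
      rcases k with _ | k
      · simp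
      obtain ⟨m, rfl⟩ := hk
      have hm : 1 ≤ m := Nat.pos_of_mul_pos_left hn
      have hpk : 0 < p ^ k * m := Nat.mul_pos (pow_pos hp.pos _) hm
      have hsub : (p^k*m).divisors ⊆ (p^(k+1)*m).properDivisors := by
        intro d hd
        rw [Nat.mem_properDivisors]
        have hd' := Nat.dvd_of_mem_divisors hd
        refine ⟨hd'.trans ⟨p, by ring⟩, (Nat.divisor_le hd).trans_lt ?_⟩
        have := hp.two_le
        rw [pow_succ]; nlinarith
      have e := hb' _ hn
      rw [← Finset.sum_sdiff hsub, hb _ hpk] at e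
      have hs : ((p:ℤ)^(k+1)) ∣ ∑ d ∈ (p^(k+1)*m).properDivisors \ (p^k*m).divisors, b d := by
        refine Finset.dvd_sum fun d hd => ?_
        rw [Finset.mem_sdiff, Nat.mem_properDivisors] at hd
        obtain ⟨⟨⟨t, ht⟩, hlt⟩, hnd⟩ := hd
        have hd0 : 0 < d := by
          rcases Nat.eq_zero_or_pos d with h | h
          · subst h; rw [zero_mul] at ht; exact absurd ht hn.ne'
          · exact h
        have hpt : ¬ p ∣ t := by
          rintro ⟨s, rfl⟩
          apply hnd
          rw [Nat.mem_divisors]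
          refine ⟨⟨s, ?_⟩, hpk.ne'⟩
          apply Nat.eq_of_mul_eq_mul_left hp.pos
          rw [← mul_assoc, ← pow_succ', ht]; ring
        have hc : Nat.Coprime (p^(k+1)) t := Nat.Coprime.pow_left _ ((Nat.Prime.coprime_iff_not_dvd hp).2 hpt)
        have hd : p^(k+1) ∣ d := hc.dvd_of_dvd_mul_right ⟨m, ht.symm⟩
        have : ((p^(k+1) : ℕ) : ℤ) ∣ (d:ℤ) := Int.natCast_dvd_natCast.2 hd
        push_cast at this
        exact this.trans (ih d hlt hd0)
      have : b (p^(k+1)*m) = ((a (p^(k+1) * m) : ℤ) - a (p^k * m)) - ∑ d ∈ (p^(k+1)*m).properDivisors \ (p^k*m).divisors, b d := by linarith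
      rw [this]
      push_cast
      exact dvd_sub (hdvd p k m hp hm) hs
  refine real_of_orbits a (fun n => (b n / n).toNat) fun n hn => ?_
  zify
  rw [← hb n hn]
  refine Finset.sum_congr rfl fun d hd => ?_
  have hd0 := Nat.pos_of_mem_divisors hd
  rw [Int.toNat_of_nonneg (Int.ediv_nonneg (h1 d hd0).1 (by positivity)), Int.mul_ediv_cancel' (h2 d hd0)]

section
open scoped QuadraticAlgebra

theorem gold_pow {R : Type*} [CommRing R] (n : ℕ) :
    (⟨0, 1⟩ : QuadraticAlgebra R 1 1) ^ (n+1) = ⟨(Nat.fib n : R), (Nat.fib (n+1) : R)⟩ := by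
  induction n with
  | zero => simp
  | succ n ih =>
    rw [pow_succ, ih, Nat.fib_add_two (n := n)]
    ext <;> simp

theorem gold_unit {R : Type*} [CommRing R] :
    IsUnit (⟨0, 1⟩ : QuadraticAlgebra R 1 1) := by
  refine IsUnit.of_mul_eq_one (⟨-1, 1⟩ : QuadraticAlgebra R 1 1) ?_
  ext <;> simp

theorem gold_char (p : ℕ) (hp : p.Prime) (h5 : p ≠ 5) :
    (⟨0, 1⟩ : QuadraticAlgebra (ZMod p) 1 1) ^ (p^2-1) = 1 := by
  have : Fact p.Prime := ⟨hp⟩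
  rcases hp.eq_two_or_odd' with rfl | hodd
  · rw [show 2^2-1 = 2+1 by norm_num, gold_pow]
    ext <;> simp [Nat.fib_add_two] <;> decide
  have : CharP (QuadraticAlgebra (ZMod p) 1 1) p :=
    charP_of_injective_algebraMap (QuadraticAlgebra.algebraMap_injective (R := ZMod p) (a := 1) (b := 1)) p
  set w : QuadraticAlgebra (ZMod p) 1 1 := ⟨0, 1⟩ with hw
  have hp1 : 1 ≤ p^2 := Nat.one_le_pow _ _ hp.pos
  have hs2 : (2 * w - 1)^2 = 5 := by
    have : w * w = w + 1 := by ext <;> simp [w]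
    linear_combination 4 * this
  obtain ⟨t, ht⟩ : ∃ t, p^2 - 1 = 2 * ((p-1) * t) := by
    obtain ⟨r, rfl⟩ := hodd
    refine ⟨r + 1, ?_⟩
    have : (2*r+1)^2 = 2 * ((2*r) * (r+1)) + 1 := by ring
    simp [this]
  have h5' : (5 : ZMod p) ≠ 0 := by
    intro h
    have : ((5:ℕ) : ZMod p) = 0 := by exact_mod_cast h
    rw [ZMod.natCast_eq_zero_iff] at this
    exact h5 ((Nat.prime_dvd_prime_iff_eq hp (by norm_num)).1 this)
  have h2' : (2 : ZMod p) ≠ 0 := by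
    intro h
    have : ((2:ℕ) : ZMod p) = 0 := by exact_mod_cast h
    rw [ZMod.natCast_eq_zero_iff] at this
    have := (Nat.prime_dvd_prime_iff_eq hp (by norm_num)).1 this
    subst this
    exact absurd hodd (by decide)
  have hcast : ∀ x : ZMod p, x ≠ 0 → (algebraMap (ZMod p) (QuadraticAlgebra (ZMod p) 1 1) x)^(p-1) = 1 := by
    intro x hx
    rw [← map_pow, ZMod.pow_card_sub_one_eq_one hx, map_one]
  have e5 : (5 : QuadraticAlgebra (ZMod p) 1 1)^(p-1) = 1 := by
    exact hcast 5 h5'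
  have e2 : (2 : QuadraticAlgebra (ZMod p) 1 1)^(p-1) = 1 := by
    exact hcast 2 h2'
  have hs : (2 * w - 1)^(p^2-1) = 1 := by
    rw [ht, pow_mul, hs2, pow_mul, e5, one_pow]
  have hs' : (2 * w - 1)^(p^2) = 2 * w - 1 := by
    rw [← Nat.sub_add_cancel hp1, pow_succ, hs, one_mul]
  have h2w : (2*w)^(p^2) = 2 * w := by
    rw [sub_pow_expChar_pow (p := p), one_pow] at hs'
    exact sub_left_injective hs'
  have e2' : (2 : QuadraticAlgebra (ZMod p) 1 1)^(p^2-1) = 1 := by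
    rw [ht, mul_left_comm, pow_mul, e2, one_pow]
  have u2 : IsUnit (2 : QuadraticAlgebra (ZMod p) 1 1) := by
    have := (IsUnit.mk0 _ h2').map (algebraMap (ZMod p) (QuadraticAlgebra (ZMod p) 1 1))
    exact this
  have u := u2.mul (gold_unit (R := ZMod p))
  have h3 : (2*w)^(p^2-1) = 1 := by
    apply u.mul_right_cancel
    rw [← hw, ← pow_succ, Nat.sub_add_cancel hp1, h2w, one_mul]
  rwa [mul_pow, e2', one_mul] at h3

theorem gold_dvd (p : ℕ) (hp : p.Prime) (h5 : p ≠ 5) :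
    (p : QuadraticAlgebra ℤ 1 1) ∣ (⟨0, 1⟩ : QuadraticAlgebra ℤ 1 1) ^ (p^2-1) - 1 := by
  have h := gold_char p hp h5
  obtain ⟨n, hn⟩ : ∃ n, p^2 - 1 = n + 1 := ⟨p^2-2, by
    have : 2^2 ≤ p^2 := Nat.pow_le_pow_left hp.two_le 2
    omega⟩
  rw [hn, gold_pow] at h ⊢
  rw [← map_natCast (algebraMap ℤ (QuadraticAlgebra ℤ 1 1)), QuadraticAlgebra.algebraMap_dvd_iff]
  have hr := congrArg QuadraticAlgebra.re h
  have hi := congrArg QuadraticAlgebra.im h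
  simp only [QuadraticAlgebra.re_one, QuadraticAlgebra.im_one] at hr hi
  constructor
  · rw [← CharP.intCast_eq_zero_iff (ZMod p) p]
    simp [hr]
  · rw [← CharP.intCast_eq_zero_iff (ZMod p) p]
    simp only [QuadraticAlgebra.im_sub, QuadraticAlgebra.im_one, sub_zero, Int.cast_natCast, hi]

/-- the Fibonacci numbers mod `p^(k+1)` have period `p^k (p^2-1)`. -/
theorem fib_period (p k : ℕ) (hp : p.Prime) (h5 : p ≠ 5) (n t : ℕ) :
    ((p : ℤ)^(k+1)) ∣ (Nat.fib (n + p^k * (p^2-1) * t) : ℤ) - Nat.fib n := by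
  have h1 := dvd_sub_pow_of_dvd_sub (gold_dvd p hp h5) k
  rw [one_pow, ← pow_mul] at h1
  have h2 : (p : QuadraticAlgebra ℤ 1 1)^(k+1) ∣
      (⟨0, 1⟩ : QuadraticAlgebra ℤ 1 1) ^ (n + p^k * (p^2-1) * t + 1) - ⟨0, 1⟩ ^ (n+1) := by
    have h3 := (h1.trans (sub_one_dvd_pow_sub_one _ t)).mul_left ((⟨0, 1⟩ : QuadraticAlgebra ℤ 1 1)^(n+1))
    convert h3 using 1
    ring
  rw [gold_pow, gold_pow, ← map_natCast (algebraMap ℤ (QuadraticAlgebra ℤ 1 1)), ← map_pow,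
    QuadraticAlgebra.algebraMap_dvd_iff] at h2
  simpa using h2.1

theorem five_pow_dvd_fib (k : ℕ) : 5^k ∣ Nat.fib (5^k) := by
  have key : ∀ n, 5 * Nat.fib n ∣ Nat.fib (5 * n) := by
    rintro (_ | m)
    · simp
    have y := Nat.fib_add_two (n := m)
    have a1 := Nat.fib_add m m
    have a2 := Nat.fib_add m (m+1)
    have a3 := Nat.fib_add (m+1) (m+1)
    have a4 := Nat.fib_add (m+m+1) (m+(m+1)+1)
    have a5 := Nat.fib_add (m+(m+1)+1) (m+(m+1)+1)
    have a6 := Nat.fib_add (m+m+1+(m+(m+1)+1)+1) m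
    ring_nf at y a1 a2 a3 a4 a5 a6 ⊢
    rw [a6, a5, a4, a3, a2, a1, y]
    refine ⟨(Nat.fib (1+m))^4 + 3 * (Nat.fib (1+m))^3 * Nat.fib m + 4 * (Nat.fib (1+m))^2 * (Nat.fib m)^2
      + 2 * (Nat.fib (1+m)) * (Nat.fib m)^3 + (Nat.fib m)^4, ?_⟩
    ring
  induction k with
  | zero => simp
  | succ k ih =>
    rw [pow_succ', ]
    exact (Nat.mul_dvd_mul_left 5 ih).trans (key _)

theorem fib_dold (j : ℕ) (hj : 0 < j) (hje : Even j) (p k m : ℕ) (hp : p.Prime) :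
    ((p:ℤ)^(k+1)) ∣ ((5 * Nat.fib ((p^(k+1)*m)^j) : ℕ) : ℤ) - (5 * Nat.fib ((p^k*m)^j) : ℕ) := by
  by_cases h5 : p = 5
  · subst h5
    have : ∀ N, 5^k ∣ N → 5^(k+1) ∣ 5 * Nat.fib N := fun N hN => by
      rw [pow_succ']
      exact Nat.mul_dvd_mul_left 5 ((five_pow_dvd_fib k).trans (Nat.fib_dvd _ _ hN))
    have a1 := this ((5^(k+1)*m)^j) (dvd_pow (Dvd.dvd.mul_right (pow_dvd_pow 5 (Nat.le_succ k)) _) hj.ne')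
    have a2 := this ((5^k*m)^j) (dvd_pow (Dvd.intro _ rfl) hj.ne')
    exact dvd_sub (by exact_mod_cast a1) (by exact_mod_cast a2)
  · obtain ⟨i, rfl⟩ := hje
    have d1 : p^2 - 1 ∣ p^(i+i) - 1 := by
      have := Nat.sub_dvd_pow_sub_pow (p^2) 1 i
      rwa [one_pow, ← pow_mul, two_mul] at this
    have d2 : p^k ∣ (p^k*m)^(i+i) := dvd_pow (Dvd.intro _ rfl) hj.ne'
    obtain ⟨t, ht⟩ := mul_dvd_mul d2 d1
    have : (p^(k+1)*m)^(i+i) = (p^k*m)^(i+i) + p^k * (p^2-1) * t := by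
      rw [← ht]
      have : p^(i+i) = 1 + (p^(i+i) - 1) := by
        have := Nat.one_le_pow (i+i) p hp.pos
        omega
      calc (p^(k+1)*m)^(i+i) = (p^k*m)^(i+i) * p^(i+i) := by ring
        _ = (p^k*m)^(i+i) * (1 + (p^(i+i) - 1)) := by rw [← this]
        _ = _ := by ring
    rw [this]
    have := (fib_period p k hp h5 ((p^k*m)^(i+i)) t).mul_left 5
    push_cast
    rwa [mul_sub] at this

theorem fib_pos_sum (j : ℕ) (hj : 0 < j) (hje : Even j) (n : ℕ) :
    ∑ d ∈ Finset.range n, Nat.fib (d^j) ≤ Nat.fib (n^j) := by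
  induction n with
  | zero => simp
  | succ n ih =>
    rw [Finset.sum_range_succ]
    rcases Nat.eq_zero_or_pos n with rfl | hn
    · simp [hj.ne']
    have h2 : n^j + 2 ≤ (n+1)^j := by
      obtain ⟨i, rfl⟩ := hje
      have h1 : n^i + 1 ≤ (n+1)^i := Nat.pow_lt_pow_left (Nat.lt_succ_self n) (by omega)
      have h0 : 1 ≤ n^i := Nat.one_le_pow _ _ hn
      rw [pow_add, pow_add]
      nlinarith
    have h3 := Nat.fib_mono h2
    rw [Nat.fib_add_two] at h3
    have := Nat.fib_mono (Nat.le_succ (n^j))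
    simp only [Nat.succ_eq_add_one] at this
    omega

theorem not_real (j : ℕ) (hj : 0 < j) : ¬ IsRealizable (fun n => Nat.fib (n ^ j)) := by
  rintro ⟨X, T, h⟩
  replace h : ∀ n : ℕ, 1 ≤ n → {x : X | T^[n] x = x}.Finite ∧
      {x : X | T^[n] x = x}.ncard = Nat.fib (n ^ j) := h
  obtain ⟨f5, c5⟩ := h 5 (by norm_num)
  obtain ⟨f1, c1⟩ := h 1 (by norm_num)
  classical
  haveI := f5.fintype
  let S : Function.End {x : X | T^[5] x = x} := fun x => ⟨T x.1, by
    have := x.2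
    simp only [Set.mem_ofPred_eq] at this ⊢
    rw [← Function.iterate_succ_apply, Function.iterate_succ_apply', this]⟩
  have hS : ∀ k x, ((S^k) x).1 = T^[k] x.1 := by
    intro k
    induction k with
    | zero => intro x; rfl
    | succ k ih =>
      intro x
      rw [pow_succ', Function.iterate_succ_apply', ← ih]
      rfl
  have hS5 : S ^ 5^1 = 1 := by
    funext x
    apply Subtype.ext
    rw [pow_one, hS]
    exact x.2
  have : Fact (Nat.Prime 5) := ⟨by norm_num⟩
  have key := Equiv.Perm.card_fixedPoints_modEq hS5
  have e1 : Fintype.card {x : X | T^[5] x = x} = Nat.fib (5^j) := by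
    rw [← c5, ← Nat.card_coe_set_eq, Nat.card_eq_fintype_card]
  have e2 : Fintype.card (Function.fixedPoints S) = 1 := by
    have : Nat.fib (1^j) = 1 := by simp
    rw [← this, ← c1, ← Nat.card_coe_set_eq, ← Nat.card_eq_fintype_card]
    refine Nat.card_congr ⟨fun x => ⟨x.1.1, congrArg Subtype.val x.2⟩, fun x => ⟨⟨x.1, ?_⟩, Subtype.ext x.2⟩, fun _ => rfl, fun _ => rfl⟩
    exact Function.iterate_fixed x.2 5
  rw [e1, e2] at key
  have d : 5 ∣ Nat.fib (5^j) := Nat.fib_dvd 5 (5^j) (dvd_pow_self 5 hj.ne')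
  have := (Nat.modEq_zero_iff_dvd.2 d).symm.trans key
  exact absurd this (by decide)

end

theorem fib_even_powers (j : ℕ) (hj : 0 < j) (hje : Even j) :
    ¬ IsRealizable (fun n => Nat.fib (n ^ j)) ∧
    IsRealizable (fun n => 5 * Nat.fib (n ^ j)) := by
  refine ⟨not_real j hj, orbits_exist _ (fun n _ => ?_)
    (fun p k m hp _ => fib_dold j hj hje p k m hp)⟩
  rw [← Finset.mul_sum]
  refine Nat.mul_le_mul_left 5 ((Finset.sum_le_sum_of_subset ?_).trans (fib_pos_sum j hj hje n))
  intro d hd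
  exact Finset.mem_range.2 (Nat.mem_properDivisors.1 hd).2
end

section
/- The sequence (|E_{2n}|)_{n≥1} of absolute values of the even-indexed Euler numbers is realizable: for all n ≥ 1, n | ∑_{d|n} μ(n/d)|E_{2d}| and ∑_{d|n} μ(n/d)|E_{2d}| ≥ 0. -/
/-- `eulerHalf n` is the Euler number `E_{2n}`, where the Euler numbers are
defined by `2 / (e^t + e^{-t}) = ∑ E_n t^n / n!` (so `E_{2n+1} = 0` and the
even-indexed ones satisfy `∑_{k ≤ n} C(2n, 2k) E_{2k} = 0` for `n ≥ 1`). -/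
def eulerHalf : ℕ → ℤ
  | 0 => 1
  | n + 1 =>
    -∑ k ∈ (Finset.range (n + 1)).attach,
      (Nat.choose (2 * (n + 1)) (2 * (k : ℕ)) : ℤ) * eulerHalf k
  decreasing_by exact Nat.lt_succ_of_le (Nat.lt_succ_iff.mp (Finset.mem_range.mp k.2))

open Finset

theorem euler_zero : eulerHalf 0 = 1 := by rw [eulerHalf]

theorem euler_rec (n : ℕ) (hn : 1 ≤ n) :
    ∑ k ∈ range (n + 1), (Nat.choose (2 * n) (2 * k) : ℤ) * eulerHalf k = 0 := by
  obtain ⟨m, rfl⟩ : ∃ m, n = m + 1 := ⟨n - 1, by omega⟩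
  rw [sum_range_succ, Nat.choose_self]
  conv_lhs => rw [eulerHalf]
  rw [Finset.sum_attach (range (m + 1))
    (fun k => (Nat.choose (2 * (m + 1)) (2 * k) : ℤ) * eulerHalf k)]
  push_cast
  ring

theorem sum_range_parity {M : Type*} [AddCommMonoid M] (f : ℕ → M) (n : ℕ) :
    ∑ i ∈ range (2 * n + 1), f i =
      ∑ k ∈ range (n + 1), f (2 * k) + ∑ k ∈ range n, f (2 * k + 1) := by
  induction n with
  | zero => simp
  | succ n ih =>
    rw [show 2 * (n + 1) + 1 = 2 * n + 1 + 1 + 1 by ring, sum_range_succ, sum_range_succ, ih,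
      sum_range_succ _ (n + 1), sum_range_succ (fun k => f (2 * k + 1)) n,
      show 2 * n + 1 + 1 = 2 * (n + 1) by ring]
    abel

theorem two_mul_even_binom {R : Type*} [CommRing R] (x : R) (n : ℕ) :
    2 * ∑ k ∈ range (n + 1), (Nat.choose (2 * n) (2 * k) : R) * x ^ (2 * k) =
      (x + 1) ^ (2 * n) + (x - 1) ^ (2 * n) := by
  rw [sub_eq_add_neg, add_pow, add_pow, sum_range_parity, sum_range_parity]
  have h1 : ∑ k ∈ range n, x ^ (2 * k + 1) * (-1) ^ (2 * n - (2 * k + 1)) *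
      (Nat.choose (2 * n) (2 * k + 1) : R) =
      - ∑ k ∈ range n, x ^ (2 * k + 1) * 1 ^ (2 * n - (2 * k + 1)) *
      (Nat.choose (2 * n) (2 * k + 1) : R) := by
    rw [← sum_neg_distrib]
    refine sum_congr rfl fun k hk => ?_
    have : Odd (2 * n - (2 * k + 1)) := by
      have := mem_range.1 hk
      exact ⟨n - k - 1, by omega⟩
    rw [this.neg_one_pow]; simp
  have h2 : ∑ k ∈ range (n + 1), x ^ (2 * k) * (-1) ^ (2 * n - 2 * k) *
      (Nat.choose (2 * n) (2 * k) : R) =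
      ∑ k ∈ range (n + 1), (Nat.choose (2 * n) (2 * k) : R) * x ^ (2 * k) := by
    refine sum_congr rfl fun k hk => ?_
    have : Even (2 * n - 2 * k) := ⟨n - k, by omega⟩
    rw [this.neg_one_pow]; ring
  have h3 : ∑ k ∈ range (n + 1), x ^ (2 * k) * 1 ^ (2 * n - 2 * k) *
      (Nat.choose (2 * n) (2 * k) : R) =
      ∑ k ∈ range (n + 1), (Nat.choose (2 * n) (2 * k) : R) * x ^ (2 * k) := by
    refine sum_congr rfl fun k hk => ?_
    rw [one_pow]; ring
  rw [h1, h2, h3]; ring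

/-! ### The prime two -/

theorem even_binom_sum (n : ℕ) (hn : 1 ≤ n) :
    ∑ k ∈ range (n + 1), (Nat.choose (2 * n) (2 * k) : ℤ) = 2 ^ (2 * n - 1) := by
  have h := two_mul_even_binom (1 : ℤ) n
  obtain ⟨m, rfl⟩ : ∃ m, n = m + 1 := ⟨n - 1, by omega⟩
  rw [show 2 * (m + 1) - 1 = 2 * m + 1 by omega]
  simp only [one_pow, mul_one] at h
  have h4 : ((1 : ℤ) + 1) ^ (2 * (m + 1)) = 2 * 2 ^ (2 * m + 1) := by
    rw [show 2 * (m + 1) = 2 * m + 1 + 1 by ring, pow_succ]; norm_num; ring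
  have h5 : ((1 : ℤ) - 1) ^ (2 * (m + 1)) = 0 := by simp
  rw [h4, h5] at h
  linarith

theorem euler_two (n : ℕ) : ∀ j : ℕ, 1 ≤ n → 2 ^ j ∣ n →
    (2 : ℤ) ^ (j + 1) ∣ eulerHalf n - 1 := by
  induction n using Nat.strong_induction_on with
  | _ n ih =>
  intro j hn hj
  have key : eulerHalf n - 1 = -(∑ k ∈ range n,
      (Nat.choose (2 * n) (2 * k) : ℤ) * (eulerHalf k - 1)) - 2 ^ (2 * n - 1) := by
    have h1 := euler_rec n hn
    have h2 := even_binom_sum n hn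
    rw [← h2]
    rw [sum_range_succ] at h1 ⊢
    simp only [mul_sub, sum_sub_distrib, mul_one]
    rw [Nat.choose_self] at *
    push_cast at *
    linarith
  rw [key]
  refine dvd_sub ((dvd_neg).2 (dvd_sum fun k hk => ?_)) (pow_dvd_pow _ ?_)
  · have hkn := mem_range.1 hk
    rcases Nat.eq_zero_or_pos k with rfl | hk0
    · simp [euler_zero]
    obtain ⟨i, k', hk', hki⟩ := Nat.exists_eq_pow_mul_and_not_dvd (n := k) hk0.ne' 2 (by norm_num)
    have hE := ih k hkn i hk0 ⟨k', hki⟩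
    have hC : k * Nat.choose (2 * n) (2 * k) = n * Nat.choose (2 * n - 1) (2 * k - 1) := by
      have := Nat.add_one_mul_choose_eq (2 * n - 1) (2 * k - 1)
      rw [show 2 * n - 1 + 1 = 2 * n by omega, show 2 * k - 1 + 1 = 2 * k by omega] at this
      linarith
    have hd : 2 ^ j ∣ 2 ^ i * Nat.choose (2 * n) (2 * k) := by
      have h1 : 2 ^ j ∣ k' * (2 ^ i * Nat.choose (2 * n) (2 * k)) := by
        have : 2 ^ j ∣ k * Nat.choose (2 * n) (2 * k) := hC ▸ hj.mul_right _
        rw [hki] at this ⊢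
        rwa [← mul_assoc, mul_comm k']
      exact Nat.Coprime.dvd_of_dvd_mul_left
        (((Nat.Prime.coprime_iff_not_dvd Nat.prime_two).2 hk').pow_left j) h1
    have hd' : (2 : ℤ) ^ j ∣ 2 ^ i * (Nat.choose (2 * n) (2 * k) : ℤ) := by exact_mod_cast hd
    obtain ⟨c, hc⟩ := hd'
    obtain ⟨e, he⟩ := hE
    refine ⟨c * e, ?_⟩
    rw [he, pow_succ, pow_succ]
    linear_combination 2 * e * hc
  · have : j < 2 ^ j := Nat.lt_two_pow_self
    have := Nat.le_of_dvd hn hj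
    omega

/-! ### Odd primes -/

theorem euler_odd (N : ℕ) (hN : Odd N) (n : ℕ) :
    (eulerHalf n : ZMod N) = ∑ j ∈ range N, (-1) ^ j * (2 * (j : ZMod N) + 1) ^ (2 * n) := by
  induction n using Nat.strong_induction_on with
  | _ n ih =>
  have h2 : IsUnit (2 : ZMod N) := by
    have := (ZMod.isUnit_iff_coprime 2 N).2 (Nat.coprime_two_left.2 hN)
    simpa using this
  rcases Nat.eq_zero_or_pos n with rfl | hn
  · rw [euler_zero]
    obtain ⟨m, rfl⟩ := hN
    simp only [mul_zero, pow_zero, mul_one]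
    rw [sum_range_parity]
    simp [pow_succ, pow_mul]
    
  have htel : ∀ M : ℕ, ∑ j ∈ range M, (-1 : ZMod N) ^ j *
      ((2 * (j : ZMod N) + 1 + 1) ^ (2 * n) + (2 * (j : ZMod N) + 1 - 1) ^ (2 * n)) =
      - (-1) ^ M * (2 * (M : ZMod N)) ^ (2 * n) := by
    intro M
    induction M with
    | zero => simp [hn.ne']
    | succ M ihM =>
      rw [sum_range_succ, ihM]
      push_cast
      rw [pow_succ, add_sub_cancel_right, mul_add 2 (M : ZMod N) 1]
      rw [show (2 * (M : ZMod N) + 1 + 1) = 2 * M + 2 * 1 by ring]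
      ring
  have hs : ∑ k ∈ range (n + 1), (Nat.choose (2 * n) (2 * k) : ZMod N) *
      (∑ j ∈ range N, (-1) ^ j * (2 * (j : ZMod N) + 1) ^ (2 * k)) = 0 := by
    apply h2.mul_left_cancel
    rw [mul_zero]
    calc _ = ∑ j ∈ range N, (-1 : ZMod N) ^ j * (2 * ∑ k ∈ range (n + 1),
          (Nat.choose (2 * n) (2 * k) : ZMod N) * (2 * (j : ZMod N) + 1) ^ (2 * k)) := by
          simp only [mul_sum]
          rw [sum_comm]
          refine sum_congr rfl fun j _ => sum_congr rfl fun k _ => ?_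
          ring
      _ = 0 := by
          simp only [two_mul_even_binom]
          rw [htel]
          simp [hn.ne']
  have hr := congrArg (Int.cast : ℤ → ZMod N) (euler_rec n hn)
  push_cast at hr
  rw [sum_range_succ, Nat.choose_self] at hr hs
  rw [sum_congr rfl (fun k hk => by rw [ih k (mem_range.1 hk)])] at hr
  have := hr.trans hs.symm
  have := add_left_cancel this
  simpa using this

theorem euler_odd_congr (p : ℕ) (hp : p.Prime) (hodd : Odd p) (k n : ℕ) (h : p ^ k ∣ n) :
    ((p ^ (k + 1) : ℕ) : ℤ) ∣ eulerHalf (p * n) - eulerHalf n := by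
  rw [← ZMod.intCast_zmod_eq_zero_iff_dvd] 
  push_cast
  rw [sub_eq_zero]
  rw [euler_odd _ hodd.pow, euler_odd _ hodd.pow]
  refine sum_congr rfl fun j _ => ?_
  congr 1
  have : Fact p.Prime := ⟨hp⟩
  have hf : (p : ℤ) ∣ (2 * (j : ℤ) + 1) ^ p - (2 * (j : ℤ) + 1) := by
    rw [← ZMod.intCast_zmod_eq_zero_iff_dvd]
    push_cast
    rw [ZMod.pow_card, sub_self]
  have hg := dvd_sub_pow_of_dvd_sub hf k
  have hg' : ((p ^ (k + 1) : ℕ) : ℤ) ∣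
    ((2 * (j : ℤ) + 1) ^ p) ^ p ^ k - (2 * (j : ℤ) + 1) ^ p ^ k := by exact_mod_cast hg
  rw [← ZMod.intCast_zmod_eq_zero_iff_dvd, ] at hg'
  push_cast at hg'
  rw [sub_eq_zero] at hg'
  obtain ⟨c, rfl⟩ := h
  rw [show 2 * (p * (p ^ k * c)) = p * p ^ k * (2 * c) by ring,
    show 2 * (p ^ k * c) = p ^ k * (2 * c) by ring, pow_mul _ (p * p ^ k), pow_mul _ p,
    hg', ← pow_mul]

/-! ### Signs and growth -/

section series
open PowerSeries

noncomputable def secS : PowerSeries ℚ :=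
  PowerSeries.mk fun n => if Even n then (-1) ^ (n / 2) * (eulerHalf (n / 2) : ℚ) / n.factorial else 0

noncomputable def cosS : PowerSeries ℚ :=
  PowerSeries.mk fun n => if Even n then (-1) ^ (n / 2) / n.factorial else 0

noncomputable def sinS : PowerSeries ℚ := - d⁄dX ℚ cosS

theorem d_sinS : d⁄dX ℚ sinS = cosS := by
  ext n
  rw [sinS, map_neg, map_neg, coeff_derivative, coeff_derivative, cosS, coeff_mk, coeff_mk]
  have hf : ((n + 1 + 1).factorial : ℚ) = (n + 2) * ((n + 1) * n.factorial) := by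
    rw [Nat.factorial_succ, Nat.factorial_succ]; push_cast; ring
  have h0 : (n.factorial : ℚ) ≠ 0 := by exact_mod_cast n.factorial_ne_zero
  have h1 : (n : ℚ) + 1 ≠ 0 := by positivity
  have h2 : (n : ℚ) + 2 ≠ 0 := by positivity
  rw [hf]
  by_cases h : Even n
  · have h' : Even (n + 1 + 1) := by simpa [Nat.even_add_one] using h
    rw [if_pos h, if_pos h', show (n + 1 + 1) / 2 = n / 2 + 1 by omega, pow_succ]
    push_cast
    field_simp
    ring
  · have h' : ¬ Even (n + 1 + 1) := by simpa [Nat.even_add_one] using h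
    rw [if_neg h, if_neg h']
    simp

theorem sec_mul_cos : secS * cosS = 1 := by
  ext n
  rw [coeff_mul, Nat.sum_antidiagonal_eq_sum_range_succ
    (fun i j => coeff i secS * coeff j cosS)]
  simp only [secS, cosS, coeff_mk, coeff_one]
  rcases Nat.even_or_odd' n with ⟨m, rfl | rfl⟩
  · rw [sum_range_parity]
    have : ∑ k ∈ range m, (if Even (2 * k + 1) then (-1) ^ ((2 * k + 1) / 2) *
      (eulerHalf ((2 * k + 1) / 2) : ℚ) / ((2 * k + 1).factorial : ℚ) else 0) *
      (if Even (2 * m - (2 * k + 1)) then (-1) ^ ((2 * m - (2 * k + 1)) / 2) /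
        ((2 * m - (2 * k + 1)).factorial : ℚ) else 0) = 0 := by
      refine sum_eq_zero fun k _ => ?_
      rw [if_neg (by simp [Nat.even_add_one]), zero_mul]
    rw [this, add_zero]
    have h2 : ∀ k ∈ range (m + 1), (if Even (2 * k) then (-1) ^ (2 * k / 2) *
      (eulerHalf (2 * k / 2) : ℚ) / ((2 * k).factorial : ℚ) else 0) *
      (if Even (2 * m - 2 * k) then (-1) ^ ((2 * m - 2 * k) / 2) /
        ((2 * m - 2 * k).factorial : ℚ) else 0) =
        (-1) ^ m / ((2 * m).factorial : ℚ) * (((2 * m).choose (2 * k) : ℚ) * eulerHalf k) := by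
      intro k hk
      have hk' : k ≤ m := by have := mem_range.1 hk; omega
      rw [if_pos (by simp), if_pos ⟨m - k, by omega⟩, Nat.cast_choose ℚ (by omega : 2 * k ≤ 2 * m),
        show 2 * k / 2 = k by omega, show (2 * m - 2 * k) / 2 = m - k by omega]
      have e : (-1 : ℚ) ^ m = (-1) ^ k * (-1) ^ (m - k) := by
        rw [← pow_add]; congr 1; omega
      have h0 : ((2 * m).factorial : ℚ) ≠ 0 := by exact_mod_cast Nat.factorial_ne_zero _
      rw [e]
      field_simp
    rw [sum_congr rfl h2, ← mul_sum]
    rcases Nat.eq_zero_or_pos m with rfl | hm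
    · simp [euler_zero]
    · have := congrArg (Int.cast : ℤ → ℚ) (euler_rec m hm)
      push_cast at this
      rw [this, mul_zero, if_neg (by omega)]
  · rw [if_neg (by omega)]
    refine sum_eq_zero fun k hk => ?_
    have hk' := mem_range.1 hk
    rcases Nat.even_or_odd' k with ⟨l, rfl | rfl⟩
    · rw [if_neg (c := Even (2 * m + 1 - 2 * l)), mul_zero]
      rw [Nat.not_even_iff_odd]
      exact ⟨m - l, by omega⟩
    · rw [if_neg (by simp [Nat.even_add_one]), zero_mul]

noncomputable def tanS : PowerSeries ℚ := sinS * secS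

theorem d_secS : d⁄dX ℚ secS = secS * tanS := by
  have h := congrArg (d⁄dX ℚ) sec_mul_cos
  rw [Derivation.leibniz, derivative_one] at h
  have hs : d⁄dX ℚ cosS = - sinS := by rw [sinS, neg_neg]
  rw [hs] at h
  simp only [smul_eq_mul] at h
  rw [tanS]
  linear_combination secS * h - (d⁄dX ℚ secS) * sec_mul_cos

theorem d_tanS : d⁄dX ℚ tanS = 1 + tanS * tanS := by
  conv_lhs => rw [tanS]
  rw [Derivation.leibniz, d_secS, d_sinS]
  simp only [smul_eq_mul]
  rw [tanS]
  linear_combination sec_mul_cos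

theorem coeff_sec_zero : coeff 0 secS = 1 := by
  rw [secS, coeff_mk]; simp [euler_zero]

theorem coeff_tan_zero : coeff 0 tanS = 0 := by
  rw [tanS, sinS, coeff_mul, Nat.antidiagonal_zero, sum_singleton, map_neg, coeff_derivative, cosS,
    coeff_mk]
  simp

theorem coeff_nonneg (n : ℕ) : ∀ m ≤ n, 0 ≤ coeff m secS ∧ 0 ≤ coeff m tanS := by
  induction n with
  | zero =>
    intro m hm
    obtain rfl : m = 0 := by omega
    rw [coeff_sec_zero, coeff_tan_zero]; norm_num
  | succ n ih =>
    intro m hm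
    rcases Nat.lt_or_ge m (n + 1) with h | h
    · exact ih m (by omega)
    obtain rfl : m = n + 1 := by omega
    have h1 := congrArg (coeff n) d_secS
    have h2 := congrArg (coeff n) d_tanS
    rw [coeff_derivative, coeff_mul] at h1
    rw [coeff_derivative, map_add, coeff_mul, coeff_one] at h2
    have hpos : (0 : ℚ) < n + 1 := by positivity
    constructor
    · refine nonneg_of_mul_nonneg_left (b := (n + 1 : ℚ)) ?_ hpos
      rw [h1]
      refine sum_nonneg fun x hx => ?_
      have := mem_antidiagonal.1 hx
      exact mul_nonneg (ih _ (by omega)).1 (ih _ (by omega)).2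
    · refine nonneg_of_mul_nonneg_left (b := (n + 1 : ℚ)) ?_ hpos
      rw [h2]
      refine add_nonneg (by split_ifs <;> norm_num) (sum_nonneg fun x hx => ?_)
      have := mem_antidiagonal.1 hx
      exact mul_nonneg (ih _ (by omega)).2 (ih _ (by omega)).2

theorem coeff_tan_one : coeff 1 tanS = 1 := by
  have h2 := congrArg (coeff 0) d_tanS
  rw [coeff_derivative, map_add, coeff_mul, Nat.antidiagonal_zero, sum_singleton, coeff_tan_zero] at h2
  simpa using h2

theorem coeff_sec_growth (n : ℕ) : coeff n secS ≤ coeff (n + 2) secS * (n + 2) := by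
  have h1 := congrArg (coeff (n + 1)) d_secS
  rw [coeff_derivative, coeff_mul] at h1
  have h2 := single_le_sum (f := fun x : ℕ × ℕ => coeff x.1 secS * coeff x.2 tanS)
    (s := antidiagonal (n + 1)) (a := (n, 1))
    (fun x _ => mul_nonneg (coeff_nonneg _ _ le_rfl).1 (coeff_nonneg _ _ le_rfl).2)
    (mem_antidiagonal.2 rfl)
  rw [← h1] at h2
  simp only [coeff_tan_one, mul_one] at h2
  push_cast at h2
  have e : (n : ℚ) + 1 + 1 = n + 2 := by ring
  rw [e] at h2
  exact h2

end series

theorem sec_even (n : ℕ) : ((-1) ^ n * eulerHalf n : ℚ) =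
    (2 * n).factorial * PowerSeries.coeff (2 * n) secS := by
  rw [secS, PowerSeries.coeff_mk, if_pos (by simp), show 2 * n / 2 = n by omega]
  have h0 : ((2 * n).factorial : ℚ) ≠ 0 := by exact_mod_cast Nat.factorial_ne_zero _
  field_simp

theorem signed_nonneg (n : ℕ) : 0 ≤ (-1) ^ n * eulerHalf n := by
  have : (0 : ℚ) ≤ ((-1) ^ n * eulerHalf n : ℚ) := by
    rw [sec_even]
    exact mul_nonneg (by positivity) (coeff_nonneg _ _ le_rfl).1
  exact_mod_cast this

theorem natAbs_eq (n : ℕ) : ((eulerHalf n).natAbs : ℤ) = (-1) ^ n * eulerHalf n := by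
  rw [Int.natCast_natAbs, ← abs_of_nonneg (signed_nonneg n), abs_mul, abs_pow]
  simp

theorem growth (n : ℕ) (hn : 1 ≤ n) : 2 * (eulerHalf n).natAbs ≤ (eulerHalf (n + 1)).natAbs := by
  have h : (2 * ((-1) ^ n * eulerHalf n) : ℚ) ≤ (-1) ^ (n + 1) * eulerHalf (n + 1) := by
    rw [sec_even, sec_even]
    have h1 := coeff_sec_growth (2 * n)
    have h2 := (coeff_nonneg (2 * n) _ le_rfl).1
    have hf : ((2 * (n + 1)).factorial : ℚ) =
        (2 * n + 2) * ((2 * n + 1) * (2 * n).factorial) := by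
      rw [show 2 * (n + 1) = 2 * n + 1 + 1 by ring, Nat.factorial_succ, Nat.factorial_succ]
      push_cast; ring
    have hn' : (1 : ℚ) ≤ n := by exact_mod_cast hn
    rw [hf, show 2 * (n + 1) = 2 * n + 2 by ring]
    push_cast at h1
    have hF : (0 : ℚ) ≤ (2 * n).factorial := by positivity
    calc 2 * (((2 * n).factorial : ℚ) * PowerSeries.coeff (2 * n) secS)
        ≤ (2 * n + 1) * (((2 * n).factorial : ℚ) * PowerSeries.coeff (2 * n) secS) :=
          mul_le_mul_of_nonneg_right (by linarith) (mul_nonneg hF h2)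
      _ ≤ (2 * n + 1) * (((2 * n).factorial : ℚ) *
          (PowerSeries.coeff (2 * n + 2) secS * (2 * n + 2))) := by gcongr
      _ = _ := by ring
  have h' : 2 * ((-1) ^ n * eulerHalf n) ≤ (-1) ^ (n + 1) * eulerHalf (n + 1) := by exact_mod_cast h
  rw [← natAbs_eq, ← natAbs_eq] at h'
  exact_mod_cast h'

/-! ### General realizability -/

theorem dold_nonneg (a : ℕ → ℕ) (ha : ∀ n, 1 ≤ n → 2 * a n ≤ a (n + 1)) (n : ℕ) (hn : 1 ≤ n) :
    0 ≤ doldSum a n := by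
  have hsum : ∀ m, ∑ d ∈ Ico 1 (m + 1), a d ≤ a (m + 1) := by
    intro m
    induction m with
    | zero => simp
    | succ m ih =>
      rw [sum_Ico_succ_top (by omega)]
      have := ha (m + 1) (by omega)
      omega
  obtain ⟨m, rfl⟩ : ∃ m, n = m + 1 := ⟨n - 1, by omega⟩
  rw [doldSum, ← Nat.insert_self_properDivisors (by omega : m + 1 ≠ 0),
    sum_insert Nat.self_notMem_properDivisors, Nat.div_self (by omega)]
  have h1 : -(∑ d ∈ (m + 1).properDivisors, (a d : ℤ)) ≤
      ∑ d ∈ (m + 1).properDivisors, (ArithmeticFunction.moebius ((m + 1) / d) : ℤ) * (a d : ℤ) := by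
    rw [← sum_neg_distrib]
    refine sum_le_sum fun d _ => ?_
    have h := ArithmeticFunction.abs_moebius_le_one (n := (m + 1) / d)
    have := (abs_le.1 h).1
    nlinarith [Int.natCast_nonneg (a d)]
  have h2 : ∑ d ∈ (m + 1).properDivisors, a d ≤ a (m + 1) := by
    refine le_trans (sum_le_sum_of_subset ?_) (hsum m)
    intro d hd
    have hd' := Nat.mem_properDivisors.1 hd
    exact mem_Ico.2 ⟨Nat.pos_of_dvd_of_pos hd'.1 (by omega), hd'.2⟩
  have h3 : ∑ d ∈ (m + 1).properDivisors, (a d : ℤ) ≤ a (m + 1) := by exact_mod_cast h2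
  rw [ArithmeticFunction.moebius_apply_one]
  linarith

theorem dold_dvd (a : ℕ → ℕ)
    (ha : ∀ p k n, p.Prime → 1 ≤ n → p ^ k ∣ n → ((p ^ (k + 1) : ℕ) : ℤ) ∣ (a (p * n) : ℤ) - a n)
    (n : ℕ) (hn : 1 ≤ n) : (n : ℤ) ∣ doldSum a n := by
  rw [Int.natCast_dvd, Nat.dvd_iff_prime_pow_dvd_dvd]
  intro p k hp hk
  rw [← Int.natCast_dvd]
  rcases Nat.eq_zero_or_pos k with rfl | hk0
  · simp
  have hpn : p ∣ n := (dvd_pow_self p hk0.ne').trans hk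
  obtain ⟨e, m, hm, hnm⟩ := Nat.exists_eq_pow_mul_and_not_dvd (n := n) (by omega) p hp.ne_one
  have hm0 : m ≠ 0 := by rintro rfl; simp at hm
  have he0 : e ≠ 0 := by rintro rfl; simp at hnm; exact hm (hnm ▸ hpn)
  have hke : p ^ k ∣ p ^ e := by
    refine Nat.Coprime.dvd_of_dvd_mul_right
        (((Nat.Prime.coprime_iff_not_dvd hp).2 hm).pow_left k) (hnm ▸ hk)
  refine dvd_trans (Int.natCast_dvd_natCast.2 hke) ?_
  have hpm : p * m ∣ n := by
    rw [hnm]; exact mul_dvd_mul_right (dvd_pow_self p he0) m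
  have h1 : doldSum a n = ∑ x ∈ n.divisors, (ArithmeticFunction.moebius x : ℤ) * (a (n / x) : ℤ) := by
    rw [doldSum, ← Nat.sum_div_divisors n
      (fun d => (ArithmeticFunction.moebius (n / d) : ℤ) * (a d : ℤ))]
    refine sum_congr rfl fun d hd => ?_
    rw [Nat.div_div_self (Nat.mem_divisors.1 hd).1 (by omega)]
  have h2 : doldSum a n =
      ∑ x ∈ (p * m).divisors, (ArithmeticFunction.moebius x : ℤ) * (a (n / x) : ℤ) := by
    rw [h1]
    symm
    refine sum_subset (Nat.divisors_subset_of_dvd (by omega) hpm) fun x hx hx' => ?_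
    rw [ArithmeticFunction.moebius_eq_zero_of_not_squarefree, zero_mul]
    intro hsq
    apply hx'
    rw [Nat.mem_divisors]
    refine ⟨?_, mul_ne_zero hp.ne_zero hm0⟩
    have hxn := (Nat.mem_divisors.1 hx).1
    by_cases hpx : p ∣ x
    · obtain ⟨y, rfl⟩ := hpx
      have hpy : Nat.Coprime p y := Nat.coprime_of_squarefree_mul hsq
      refine mul_dvd_mul_left p ?_
      exact Nat.Coprime.dvd_of_dvd_mul_left (hpy.symm.pow_right e)
        (hnm ▸ (dvd_mul_left y p).trans hxn)
    · refine Dvd.dvd.mul_left ?_ p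
      exact Nat.Coprime.dvd_of_dvd_mul_left
        (((Nat.Prime.coprime_iff_not_dvd hp).2 hpx).symm.pow_right e) (hnm ▸ hxn)
  have hdiv : (p * m).divisors = m.divisors ∪ m.divisors.image (p * ·) := by
    ext x
    simp only [mem_union, mem_image, Nat.mem_divisors]
    constructor
    · rintro ⟨hx, -⟩
      by_cases hpx : p ∣ x
      · obtain ⟨y, rfl⟩ := hpx
        exact Or.inr ⟨y, ⟨Nat.dvd_of_mul_dvd_mul_left hp.pos hx, hm0⟩, rfl⟩
      · exact Or.inl ⟨Nat.Coprime.dvd_of_dvd_mul_left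
          ((Nat.Prime.coprime_iff_not_dvd hp).2 hpx).symm hx, hm0⟩
    · rintro (⟨h, -⟩ | ⟨y, ⟨h, -⟩, rfl⟩)
      · exact ⟨h.mul_left p, mul_ne_zero hp.ne_zero hm0⟩
      · exact ⟨mul_dvd_mul_left p h, mul_ne_zero hp.ne_zero hm0⟩
  have hdis : Disjoint m.divisors (m.divisors.image (p * ·)) := by
    rw [disjoint_left]
    intro x hx hx'
    obtain ⟨y, _, rfl⟩ := mem_image.1 hx'
    exact hm ((dvd_mul_right p y).trans (Nat.mem_divisors.1 hx).1)
  rw [h2, hdiv, sum_union hdis, sum_image (fun x _ y _ h => Nat.eq_of_mul_eq_mul_left hp.pos h),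
    ← sum_add_distrib]
  refine dvd_sum fun x hx => ?_
  have hxm := (Nat.mem_divisors.1 hx).1
  have hcop : Nat.Coprime p x :=
    (Nat.Prime.coprime_iff_not_dvd hp).2 fun h => hm (h.trans hxm)
  rw [ArithmeticFunction.isMultiplicative_moebius.map_mul_of_coprime hcop,
    ArithmeticFunction.moebius_apply_prime hp]
  obtain ⟨y, rfl⟩ := hxm
  obtain ⟨f, rfl⟩ : ∃ f, e = f + 1 := ⟨e - 1, by omega⟩
  have hx0 : 0 < x := Nat.pos_of_ne_zero (by rintro rfl; simp at hm0)
  have hy0 : 0 < y := Nat.pos_of_ne_zero (by rintro rfl; simp at hm0)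
  have e1 : n / x = p * (p ^ f * y) := by
    rw [hnm]; exact Nat.div_eq_of_eq_mul_left hx0 (by ring)
  have e2 : n / (p * x) = p ^ f * y := by
    rw [hnm]; exact Nat.div_eq_of_eq_mul_left (Nat.mul_pos hp.pos hx0) (by ring)
  rw [e1, e2]
  have := ha p f (p ^ f * y) hp (Nat.mul_pos (pow_pos hp.pos f) hy0) (dvd_mul_right _ _)
  convert this.mul_left (ArithmeticFunction.moebius x) using 1
  ring

theorem realizable_of_dold (a : ℕ → ℕ)
    (h : ∀ n : ℕ, 1 ≤ n → (n : ℤ) ∣ doldSum a n ∧ 0 ≤ doldSum a n) : IsRealizable a := by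
  have hb : ∀ n : ℕ, ∃ b : ℕ, 1 ≤ n → doldSum a n = n * b := by
    intro n
    by_cases hn : 1 ≤ n
    · obtain ⟨⟨c, hc⟩, h0⟩ := h n hn
      have : 0 ≤ c := by
        rw [hc] at h0
        exact nonneg_of_mul_nonneg_right h0 (by exact_mod_cast hn)
      exact ⟨c.toNat, fun _ => by rw [hc, Int.toNat_of_nonneg this]⟩
    · exact ⟨0, fun h => absurd h hn⟩
  choose b hb using hb
  have hinv : ∀ n > 0, ∑ d ∈ n.divisors, d * b d = a n := by
    have := (ArithmeticFunction.sum_eq_iff_sum_mul_moebius_eq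
      (f := fun d => ((d * b d : ℕ) : ℤ)) (g := fun n => (a n : ℤ))).2 (by
        intro n hn
        rw [Nat.cast_mul, ← hb n hn, doldSum,
          ← Nat.sum_divisorsAntidiagonal' (fun x y => (ArithmeticFunction.moebius x : ℤ) * (a y : ℤ))]
        simp)
    intro n hn
    exact_mod_cast this n hn
  let T : (Σ n : ℕ, Fin (b (n + 1)) × ZMod (n + 1)) → (Σ n : ℕ, Fin (b (n + 1)) × ZMod (n + 1)) :=
    fun x => ⟨x.1, x.2.1, x.2.2 + 1⟩
  have hT : ∀ m x, T^[m] x = ⟨x.1, x.2.1, x.2.2 + m⟩ := by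
    intro m
    induction m with
    | zero => intro x; simp
    | succ m ih =>
      intro x
      rw [Function.iterate_succ_apply, ih]
      simp only [T]
      push_cast
      rw [add_assoc, add_comm (1 : ZMod (x.1 + 1))]
  refine ⟨_, T, fun n hn => ?_⟩
  have hset : {x | T^[n] x = x} = ((((range n).filter fun i => i + 1 ∣ n).sigma
      fun i => (univ : Finset (Fin (b (i + 1)) × ZMod (i + 1))) :
        Finset (Σ n : ℕ, Fin (b (n + 1)) × ZMod (n + 1))) : Set _) := by
    ext ⟨i, c, z⟩
    simp only [Set.mem_setOf_eq, hT, coe_sigma, Set.mem_sigma_iff, mem_coe, mem_filter, mem_range,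
      mem_univ, and_true, Sigma.mk.injEq, heq_eq_eq, Prod.mk.injEq, true_and, coe_univ,
      Set.mem_univ, add_eq_left, ZMod.natCast_eq_zero_iff]
    constructor
    · intro hd
      exact ⟨Nat.le_of_dvd hn hd, hd⟩
    · exact fun hd => hd.2
  rw [hset]
  refine ⟨Finset.finite_toSet _, ?_⟩
  rw [Set.ncard_coe_finset, card_sigma, ← hinv n hn]
  symm
  refine sum_bij' (fun d _ => d - 1) (fun i _ => i + 1) ?_ ?_ ?_ ?_ ?_
  · intro d hd
    have hd' := Nat.mem_divisors.1 hd
    have h0 := Nat.pos_of_dvd_of_pos hd'.1 hn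
    have h1 := Nat.le_of_dvd hn hd'.1
    rw [mem_filter, mem_range, Nat.sub_add_cancel h0]
    exact ⟨by omega, hd'.1⟩
  · intro i hi
    exact Nat.mem_divisors.2 ⟨(mem_filter.1 hi).2, by omega⟩
  · intro d hd
    have h0 := Nat.pos_of_dvd_of_pos (Nat.mem_divisors.1 hd).1 hn
    exact Nat.sub_add_cancel h0
  · intro i _
    rfl
  · intro d hd
    have h0 := Nat.pos_of_dvd_of_pos (Nat.mem_divisors.1 hd).1 hn
    obtain ⟨i, rfl⟩ : ∃ i, d = i + 1 := ⟨d - 1, by omega⟩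
    simp [ZMod.card, mul_comm]

theorem euler_congr (p k n : ℕ) (hp : p.Prime) (hn : 1 ≤ n) (h : p ^ k ∣ n) :
    ((p ^ (k + 1) : ℕ) : ℤ) ∣
      ((eulerHalf (p * n)).natAbs : ℤ) - ((eulerHalf n).natAbs : ℤ) := by
  rw [natAbs_eq, natAbs_eq]
  rcases hp.eq_two_or_odd' with rfl | hodd
  · have h1 := euler_two n k hn h
    have h2 := euler_two (2 * n) k (by omega) (h.mul_left 2)
    have e1 : ((-1 : ℤ)) ^ (2 * n) = 1 := by simp
    rw [e1]
    push_cast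
    rcases Nat.even_or_odd n with hev | hod
    · rw [hev.neg_one_pow]
      have e2 : 1 * eulerHalf (2 * n) - 1 * eulerHalf n =
          (eulerHalf (2 * n) - 1) - (eulerHalf n - 1) := by ring
      rw [e2]
      exact dvd_sub h2 h1
    · have : k = 0 := by
        by_contra hk
        exact (Nat.not_even_iff_odd.2 hod) (even_iff_two_dvd.2 ((dvd_pow_self 2 hk).trans h))
      subst this
      rw [hod.neg_one_pow]
      obtain ⟨u, hu⟩ := h1
      obtain ⟨v, hv⟩ := h2
      exact ⟨u + v + 1, by linear_combination hu + hv⟩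
  · have h1 := euler_odd_congr p hp hodd k n h
    have e1 : ((-1 : ℤ)) ^ (p * n) = (-1) ^ n := by rw [pow_mul, hodd.neg_one_pow]
    rw [e1, ← mul_sub]
    exact h1.mul_left _

theorem abs_euler_realizable :
    IsRealizable (fun n => (eulerHalf n).natAbs) ∧
    ∀ n : ℕ, 1 ≤ n →
      (n : ℤ) ∣ doldSum (fun m => (eulerHalf m).natAbs) n ∧
      0 ≤ doldSum (fun m => (eulerHalf m).natAbs) n := by
  have key : ∀ n : ℕ, 1 ≤ n →
      (n : ℤ) ∣ doldSum (fun m => (eulerHalf m).natAbs) n ∧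
      0 ≤ doldSum (fun m => (eulerHalf m).natAbs) n := fun n hn =>
    ⟨dold_dvd _ euler_congr n hn, dold_nonneg _ growth n hn⟩
  exact ⟨realizable_of_dold _ key, key⟩
end

section
/- Writing |B_{2n}/(2n)| = τ_n/β_n in lowest terms with τ_n, β_n ≥ 1, the denominator sequence (β_n)_{n≥1} is realizable. -/
/-- The numerator `τ_n` of `|B_{2n}/(2n)|` in lowest terms. -/
def bernoulliTau (n : ℕ) : ℕ := (|bernoulli (2 * n) / (2 * n : ℚ)|).num.natAbs

/-- The denominator `β_n` of `|B_{2n}/(2n)|` in lowest terms. -/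
def bernoulliBeta (n : ℕ) : ℕ := (|bernoulli (2 * n) / (2 * n : ℚ)|).den


/-- Adding a multiple of `m` to `r`: the `k`-th power modulo `m ^ 2`. -/
lemma aux_pow_expand (r m q : ℤ) (k : ℕ) :
    ∃ w : ℤ, (r + m * q) ^ k = r ^ k + k * m * (q * r ^ (k - 1)) + m ^ 2 * w := by
  obtain ⟨w, hw⟩ := Polynomial.powAddExpansion r (m * q) k
  exact ⟨w * q ^ 2, by rw [hw]; ring⟩

lemma aux_sum_perm (a m : ℕ) (hm : 0 < m) (ham : a.Coprime m) (k : ℕ) :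
    ∑ v ∈ Finset.range m, (((a * v) % m : ℕ) : ℤ) ^ k = ∑ v ∈ Finset.range m, (v : ℤ) ^ k := by
  have hinj : Set.InjOn (fun v => (a * v) % m) (Finset.range m : Set ℕ) := by
    intro x hx y hy hxy
    have h : a * x ≡ a * y [MOD m] := hxy
    have h2 := Nat.ModEq.cancel_left_of_coprime (by rwa [Nat.gcd_comm]) h
    exact h2.eq_of_lt_of_lt (by simpa using hx) (by simpa using hy)
  have himg : (Finset.range m).image (fun v => (a * v) % m) = Finset.range m := by
    apply Finset.eq_of_subset_of_card_le
    · intro x hx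
      simp only [Finset.mem_image, Finset.mem_range] at hx ⊢
      obtain ⟨v, _, rfl⟩ := hx
      exact Nat.mod_lt _ hm
    · rw [Finset.card_image_of_injOn hinj]
  conv_rhs => rw [← himg]
  rw [Finset.sum_image hinj]

/-- Voronoi-type congruence. -/
lemma aux_voronoi (a m : ℕ) (hm : 0 < m) (ham : a.Coprime m) (k : ℕ) :
    ∃ z w : ℤ, ((a : ℤ) ^ k - 1) * ∑ v ∈ Finset.range m, (v : ℤ) ^ k
      = k * m * z + (m : ℤ) ^ 2 * w := by
  have h : ∀ v : ℕ, ∃ z w : ℤ, (a : ℤ) ^ k * (v : ℤ) ^ k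
      = (((a * v) % m : ℕ) : ℤ) ^ k + k * m * z + (m : ℤ) ^ 2 * w := by
    intro v
    obtain ⟨w, hw⟩ := aux_pow_expand (((a * v) % m : ℕ) : ℤ) m ((a * v / m : ℕ) : ℤ) k
    refine ⟨((a * v / m : ℕ) : ℤ) * (((a * v) % m : ℕ) : ℤ) ^ (k - 1), w, ?_⟩
    rw [← hw, ← mul_pow]
    congr 1
    exact_mod_cast (Nat.mod_add_div (a * v) m).symm
  choose z w hzw using h
  refine ⟨∑ v ∈ Finset.range m, z v, ∑ v ∈ Finset.range m, w v, ?_⟩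
  rw [sub_mul, one_mul, Finset.mul_sum, Finset.sum_congr rfl (fun v _ => hzw v),
    Finset.sum_add_distrib, Finset.sum_add_distrib, aux_sum_perm a m hm ham, Finset.mul_sum,
    Finset.mul_sum]
  ring

lemma aux_limit (p : ℕ) [Fact p.Prime] (k : ℕ) :
    Filter.Tendsto (fun N : ℕ => (((∑ v ∈ Finset.range (p ^ N), (v : ℤ) ^ k : ℤ) : ℚ_[p])
      / ((p : ℚ_[p]) ^ N))) Filter.atTop (nhds ((bernoulli k : ℚ) : ℚ_[p])) := by
  have hp0 : (p : ℚ_[p]) ≠ 0 := by exact_mod_cast (Fact.out : p.Prime).ne_zero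
  have h0 : Filter.Tendsto (fun N : ℕ => (p : ℚ_[p]) ^ N) Filter.atTop (nhds 0) :=
    tendsto_pow_atTop_nhds_zero_of_norm_lt_one Padic.norm_p_lt_one
  let F : ℚ_[p] → ℚ_[p] := fun x => ∑ i ∈ Finset.range (k + 1),
    ((bernoulli i : ℚ) : ℚ_[p]) * ((k + 1).choose i) * x ^ (k - i) / (k + 1)
  have hF : Continuous F := by fun_prop
  have hF0 : F 0 = ((bernoulli k : ℚ) : ℚ_[p]) := by
    simp only [F]
    rw [Finset.sum_range_succ, Finset.sum_eq_zero]
    · have : (k : ℚ_[p]) + 1 ≠ 0 := by exact_mod_cast Nat.succ_ne_zero k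
      simp [Nat.choose_succ_self_right]
      field_simp
    · intro i hi
      rw [Finset.mem_range] at hi
      simp [show k - i ≠ 0 by omega]
  rw [← hF0]
  refine ((hF.tendsto 0).comp h0).congr ?_
  intro N
  have h1 := sum_range_pow (p ^ N) k
  have h2 : ((∑ v ∈ Finset.range (p ^ N), (v : ℤ) ^ k : ℤ) : ℚ_[p]) =
     ((∑ v ∈ Finset.range (p ^ N), (v : ℚ) ^ k : ℚ) : ℚ_[p]) := by push_cast; rfl
  rw [h2, h1]
  simp only [F, Function.comp]
  push_cast
  rw [Finset.sum_div]
  refine Finset.sum_congr rfl fun i hi => ?_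
  rw [Finset.mem_range] at hi
  rw [show k + 1 - i = (k - i) + 1 by omega, pow_succ]
  field_simp

/-- p-integrality of `B_k / k` when `(p - 1) ∤ k`. -/
lemma aux_integral (p : ℕ) [hp : Fact p.Prime] (k : ℕ) (hk : 0 < k) (h : ¬ (p - 1) ∣ k) :
    ‖((bernoulli k / k : ℚ) : ℚ_[p])‖ ≤ 1 := by
  obtain ⟨g, hg⟩ := IsCyclic.exists_generator (α := (ZMod p)ˣ)
  have hord : orderOf g = p - 1 := by
    rw [orderOf_eq_card_of_forall_mem_zpowers hg, Nat.card_eq_fintype_card, ZMod.card_units]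
  set a : ℕ := (g : ZMod p).val with ha
  have hag : (a : ZMod p) = g := by simp [ha]
  have hcop : a.Coprime p := ZMod.val_coe_unit_coprime g
  have hnd : ¬ (p : ℤ) ∣ (a : ℤ) ^ k - 1 := by
    rw [← ZMod.intCast_zmod_eq_zero_iff_dvd]
    push_cast
    rw [hag, sub_eq_zero]
    intro h1
    apply h
    rw [← hord]
    apply orderOf_dvd_of_pow_eq_one
    ext
    simpa using h1
  have hnorm : ‖((((a : ℤ) ^ k - 1 : ℤ)) : ℚ_[p])‖ = 1 := by
    apply le_antisymm (Padic.norm_int_le_one _)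
    by_contra hlt
    exact hnd (Padic.norm_intCast_lt_one_iff.1 (not_le.1 hlt))
  have hp0 : (p : ℚ_[p]) ≠ 0 := by exact_mod_cast (Fact.out : p.Prime).ne_zero
  have hk0 : (k : ℚ_[p]) ≠ 0 := by exact_mod_cast hk.ne'
  have hlim := (((aux_limit p k).const_mul ((((a : ℤ) ^ k - 1 : ℤ)) : ℚ_[p])).div_const
    (k : ℚ_[p])).norm
  have hlim2 : Filter.Tendsto (fun N : ℕ => ‖(p : ℚ_[p]) ^ N / k‖) Filter.atTop (nhds 0) := by
    have h0 : Filter.Tendsto (fun N : ℕ => (p : ℚ_[p]) ^ N) Filter.atTop (nhds 0) :=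
      tendsto_pow_atTop_nhds_zero_of_norm_lt_one Padic.norm_p_lt_one
    simpa using (h0.div_const (k : ℚ_[p])).norm
  have hfin : ‖((((a : ℤ) ^ k - 1 : ℤ)) : ℚ_[p]) * ((bernoulli k : ℚ) : ℚ_[p]) / k‖ ≤ 1 := by
    refine le_of_tendsto hlim ?_
    filter_upwards [hlim2.eventually (gt_mem_nhds one_pos)] with N hN
    obtain ⟨z, w, hzw⟩ := aux_voronoi a (p ^ N) (pow_pos hp.out.pos _) (hcop.pow_right N) k
    have e : ((((a : ℤ) ^ k - 1 : ℤ)) : ℚ_[p]) *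
        (((∑ v ∈ Finset.range (p ^ N), (v : ℤ) ^ k : ℤ) : ℚ_[p]) / (p : ℚ_[p]) ^ N) / k
        = (z : ℚ_[p]) + (p : ℚ_[p]) ^ N / k * (w : ℚ_[p]) := by
      rw [← mul_div_assoc, ← Int.cast_mul, hzw]
      push_cast
      field_simp
    rw [e]
    refine (Padic.nonarchimedean _ _).trans (max_le (Padic.norm_int_le_one _) ?_)
    rw [norm_mul]
    exact mul_le_one₀ hN.le (norm_nonneg _) (Padic.norm_int_le_one _)
  rw [mul_div_assoc, norm_mul, hnorm, one_mul] at hfin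
  push_cast
  exact hfin

/-- von Staudt–Clausen: exact valuation. -/
lemma aux_clausen (p : ℕ) [hp : Fact p.Prime] (n : ℕ) (hn : 0 < n) (h : (p - 1) ∣ 2 * n) :
    padicNorm p (bernoulli (2 * n)) = p := by
  obtain ⟨I, hI⟩ := Bernoulli.vonStaudt_clausen n
  set S := (Finset.range (2 * n + 2)).filter (fun p => p.Prime ∧ (p - 1) ∣ 2 * n) with hS
  have hpS : p ∈ S := by
    simp only [hS, Finset.mem_filter, Finset.mem_range]
    have := Nat.le_of_dvd (by omega) h
    exact ⟨by omega, hp.out, h⟩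
  have hp1 : (1 : ℚ) < p := by exact_mod_cast hp.out.one_lt
  rw [← Finset.add_sum_erase _ _ hpS] at hI
  have hB : bernoulli (2 * n) = -(1 / (p : ℚ)) + ((I : ℚ) - ∑ q ∈ S.erase p, (1 : ℚ) / q) := by
    linarith
  have hn1 : padicNorm p (-(1 / (p : ℚ))) = p := by
    rw [padicNorm.neg, padicNorm.div, padicNorm.one, padicNorm.padicNorm_p_of_prime]
    simp
  have hn2 : padicNorm p ((I : ℚ) - ∑ q ∈ S.erase p, (1 : ℚ) / q) ≤ 1 := by
    refine padicNorm.sub.trans (max_le (padicNorm.of_int _) (padicNorm.sum_le' ?_ zero_le_one))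
    intro q hq
    rw [Finset.mem_erase, hS, Finset.mem_filter] at hq
    have : padicNorm p (q : ℚ) = 1 := by
      rw [padicNorm.nat_eq_one_iff]
      intro hd
      exact hq.1 ((Nat.prime_dvd_prime_iff_eq hp.out hq.2.2.1).1 hd).symm
    rw [padicNorm.div, padicNorm.one, this]
    simp
  rw [hB, padicNorm.add_eq_max_of_ne (by rw [hn1]; linarith), hn1]
  exact max_eq_left (by linarith)

lemma aux_den (p : ℕ) [hp : Fact p.Prime] (x : ℚ) (e : ℕ) (he : 0 < e) :
    p ^ e ∣ x.den ↔ padicValRat p x ≤ -(e : ℤ) := by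
  rw [padicValNat_dvd_iff_le x.den_ne_zero, padicValRat_def]
  by_cases hd : p ∣ x.den
  · have : ¬ p ∣ x.num.natAbs := by
      intro h2
      have := Nat.dvd_gcd h2 hd
      rw [x.reduced] at this
      exact hp.out.one_lt.ne' (Nat.dvd_one.1 this)
    rw [padicValInt, padicValNat.eq_zero_of_not_dvd this]
    omega
  · rw [padicValNat.eq_zero_of_not_dvd hd]
    omega

lemma aux_beta (p : ℕ) [hp : Fact p.Prime] (n e : ℕ) (hn : 0 < n) (he : 0 < e) :
    p ^ e ∣ bernoulliBeta n ↔ (p - 1 ∣ 2 * n ∧ p ^ (e - 1) ∣ 2 * n) := by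
  unfold bernoulliBeta
  rw [Rat.den_abs_eq_den]
  have hn0 : ((2 * n : ℕ) : ℚ) ≠ 0 := by positivity
  have hcast : (2 * n : ℚ) = ((2 * n : ℕ) : ℚ) := by push_cast; rfl
  rw [hcast]
  by_cases h : p - 1 ∣ 2 * n
  · have hB := aux_clausen p n hn h
    have hp1 : (1 : ℚ) < p := by exact_mod_cast hp.out.one_lt
    have hB0 : bernoulli (2 * n) ≠ 0 := by
      intro h0
      rw [h0, padicNorm.zero] at hB
      linarith
    have hv : padicValRat p (bernoulli (2 * n)) = -1 := by
      rw [padicNorm.eq_zpow_of_nonzero hB0] at hB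
      have h1 : (p : ℚ) ^ (-padicValRat p (bernoulli (2 * n))) = (p : ℚ) ^ (1 : ℤ) := by
        rw [hB, zpow_one]
      have := zpow_right_injective₀ (by linarith) hp1.ne' h1
      omega
    rw [aux_den p _ e he, padicValRat.div hB0 hn0, hv, padicValRat.of_nat,
      padicValNat_dvd_iff_le (by omega)]
    simp only [h, true_and]
    omega
  · simp only [h, false_and, iff_false]
    have h1 := aux_integral p (2 * n) (by omega) h
    intro hd
    have hd1 : p ^ 1 ∣ _ := (pow_dvd_pow p he).trans hd
    rw [aux_den p _ 1 one_pos] at hd1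
    rw [Padic.eq_padicNorm] at h1
    have h0 : bernoulli (2 * n) / ((2 * n : ℕ) : ℚ) ≠ 0 := by
      intro h0
      rw [h0] at hd1
      simp at hd1
    have h2 : padicNorm p (bernoulli (2 * n) / ((2 * n : ℕ) : ℚ)) ≤ 1 := by exact_mod_cast h1
    rw [padicNorm.eq_zpow_of_nonzero h0] at h2
    have hp1 : (1 : ℚ) < p := by exact_mod_cast hp.out.one_lt
    have := (zpow_le_one_iff_right₀ hp1).1 h2
    omega

lemma aux_unit_primepow (p e : ℕ) (hp : p.Prime) (he : 0 < e) :
    ∃ b : (ZMod (p ^ e))ˣ, ∀ n, 0 < n → (b ^ n = 1 ↔ p ^ e ∣ bernoulliBeta n) := by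
  have : Fact p.Prime := ⟨hp⟩
  by_cases hp2 : p = 2
  · subst hp2
    rcases Nat.lt_or_ge e 2 with h2 | h2
    · obtain rfl : e = 1 := by omega
      refine ⟨1, fun n hn => ?_⟩
      rw [aux_beta 2 n 1 hn one_pos]
      simp
    · obtain ⟨f, rfl⟩ := Nat.exists_eq_add_of_le' h2
      refine ⟨ZMod.unitOfCoprime 5 (Nat.Coprime.pow_right _ (by norm_num)), fun n hn => ?_⟩
      rw [aux_beta 2 n _ hn (by omega), ← orderOf_dvd_iff_pow_eq_one, ← orderOf_units,
        ZMod.coe_unitOfCoprime, Nat.cast_ofNat, ZMod.orderOf_five]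
      rw [show f + 2 - 1 = f + 1 by omega, pow_succ', Nat.mul_dvd_mul_iff_left (by norm_num)]
      simp
  · have := ZMod.isCyclic_units_of_prime_pow p hp hp2 e
    obtain ⟨g, hg⟩ := IsCyclic.exists_generator (α := (ZMod (p ^ e))ˣ)
    have hord : orderOf g = p ^ (e - 1) * (p - 1) := by
      rw [orderOf_eq_card_of_forall_mem_zpowers hg, Nat.card_eq_fintype_card,
        ZMod.card_units_eq_totient, Nat.totient_prime_pow hp he]
    refine ⟨g ^ 2, fun n hn => ?_⟩
    rw [aux_beta p n _ hn he, ← pow_mul, ← orderOf_dvd_iff_pow_eq_one, hord]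
    have hc : (p ^ (e - 1)).Coprime (p - 1) := by
      apply Nat.Coprime.pow_left
      rw [Nat.coprime_self_sub_right hp.one_le]
      simp
    constructor
    · intro h
      exact ⟨(Dvd.intro_left _ rfl).trans h, (Dvd.intro _ rfl).trans h⟩
    · rintro ⟨h1, h2⟩
      exact hc.mul_dvd_of_dvd_of_dvd h2 h1

lemma aux_unit (m : ℕ) (hm : 0 < m) :
    ∃ b : (ZMod m)ˣ, ∀ n, 0 < n → (b ^ n = 1 ↔ m ∣ bernoulliBeta n) := by
  induction m using Nat.recOnPosPrimePosCoprime with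
  | prime_pow p e hp he => exact aux_unit_primepow p e hp he
  | zero => omega
  | one => exact ⟨1, fun n _ => by simp⟩
  | coprime a c ha hc hac iha ihc =>
    obtain ⟨x, hx⟩ := iha (by omega)
    obtain ⟨y, hy⟩ := ihc (by omega)
    let E : (ZMod (a * c))ˣ ≃* (ZMod a)ˣ × (ZMod c)ˣ :=
      (Units.mapEquiv (ZMod.chineseRemainder hac).toMulEquiv).trans MulEquiv.prodUnits
    refine ⟨E.symm (x, y), fun n hn => ?_⟩
    rw [← map_pow, EmbeddingLike.map_eq_one_iff, Prod.pow_mk, Prod.mk_eq_one, hx n hn, hy n hn]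
    exact ⟨fun h => hac.mul_dvd_of_dvd_of_dvd h.1 h.2,
      fun h => ⟨(Dvd.intro _ rfl).trans h, (Dvd.intro_left _ rfl).trans h⟩⟩

theorem bernoulli_denominators_realizable : IsRealizable bernoulliBeta := by
  choose b hb using fun m : ℕ+ => aux_unit m m.pos
  refine ⟨Σ m : ℕ+, (ZMod m)ˣ, fun x => ⟨x.1, b x.1 * x.2⟩, fun n hn => ?_⟩
  have hiter : ∀ (k : ℕ) (x : Σ m : ℕ+, (ZMod m)ˣ),
      (fun x : Σ m : ℕ+, (ZMod m)ˣ => (⟨x.1, b x.1 * x.2⟩ : Σ m : ℕ+, (ZMod m)ˣ))^[k] x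
        = ⟨x.1, b x.1 ^ k * x.2⟩ := by
    intro k
    induction k with
    | zero => intro x; simp
    | succ k ih =>
      intro x
      rw [Function.iterate_succ_apply', ih, pow_succ']
      simp [mul_assoc]
  have hβ : 0 < bernoulliBeta n := Rat.den_pos _
  obtain ⟨S, hSdef⟩ : ∃ S : Finset ℕ+, S = (bernoulliBeta n).divisors.image Nat.toPNat' :=
    ⟨_, rfl⟩
  have hS : ∀ m : ℕ+, m ∈ S ↔ (m : ℕ) ∣ bernoulliBeta n := by
    intro m
    rw [hSdef, Finset.mem_image]
    constructor
    · rintro ⟨d, hd, rfl⟩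
      rw [Nat.toPNat'_coe, if_pos (Nat.pos_of_mem_divisors hd)]
      exact Nat.dvd_of_mem_divisors hd
    · intro h
      exact ⟨m, Nat.mem_divisors.2 ⟨h, hβ.ne'⟩, PNat.coe_toPNat' m⟩
  have hset : {x : Σ m : ℕ+, (ZMod m)ˣ |
      (fun x : Σ m : ℕ+, (ZMod m)ˣ => (⟨x.1, b x.1 * x.2⟩ : Σ m : ℕ+, (ZMod m)ˣ))^[n] x = x}
      = ((S.sigma fun m => (Finset.univ : Finset (ZMod m)ˣ)) :
        Finset (Σ m : ℕ+, (ZMod m)ˣ)) := by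
    ext ⟨m, u⟩
    simp only [Set.mem_ofPred_eq, hiter, Finset.coe_sigma, Set.mem_sigma_iff, Finset.mem_coe, hS,
      Finset.mem_univ, and_true, ← hb m n hn]
    simp
  rw [hset]
  refine ⟨Finset.finite_toSet _, ?_⟩
  rw [Set.ncard_coe_finset, Finset.card_sigma]
  simp only [Finset.card_univ, ZMod.card_units_eq_totient]
  rw [hSdef, Finset.sum_image]
  · conv_rhs => rw [← Nat.sum_totient (bernoulliBeta n)]
    refine Finset.sum_congr rfl fun d hd => ?_
    rw [Nat.toPNat'_coe, if_pos (Nat.pos_of_mem_divisors hd)]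
  · intro x hx y hy h
    have h' := congrArg PNat.val h
    simpa [Nat.toPNat'_coe, Nat.pos_of_mem_divisors hx, Nat.pos_of_mem_divisors hy] using h'
end
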